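/- Let g₀(x) = 3x² − 1, g₁(x) = 3x² − 3x + 1, g₂(x) = 3x² + 3x + 1. Let q be a prime with q ≡ 1 (mod 6), and let s be an integer with q ∣ g₂(s). Then for every integer x, Φ₃(g₀(q·x + s)) = q · f₁₁(x) · f₁₂(x), where f₁₁(x) = 3q²·x² + (6s − 3)·q·x + g₁(s) and f₁₂(x) = 3q·x² + (6s + 3)·x + g₂(s)/q, with Φ₃(x) = x² + x + 1. Moreover f₁₁ and f₁₂ are irreducible as polynomials over ℤ. -/

import Mathlib

open Polynomial

/-- The 3rd cyclotomic polynomial, evaluated at an integer. -/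
def Phi3 (x : ℤ) : ℤ := x ^ 2 + x + 1

def g0 (x : ℤ) : ℤ := 3 * x ^ 2 - 1

def g1 (x : ℤ) : ℤ := 3 * x ^ 2 - 3 * x + 1

def g2 (x : ℤ) : ℤ := 3 * x ^ 2 + 3 * x + 1

theorem coeff_quadratic {R : Type*} [Semiring R] (a b c : R) :
    (C a * X ^ 2 + C b * X + C c).coeff 0 = c ∧
    (C a * X ^ 2 + C b * X + C c).coeff 1 = b ∧
    (C a * X ^ 2 + C b * X + C c).coeff 2 = a := by
  simp only [coeff_add, coeff_C_mul, coeff_X_pow, coeff_X, coeff_C]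
  simp

/-- A primitive integral quadratic with negative discriminant is irreducible. -/
theorem irreducible_quadratic_of_discrim_neg {a b c : ℤ} (hdisc : discrim a b c < 0)
    (hprim : ∀ d : ℤ, d ∣ a → d ∣ b → d ∣ c → IsUnit d) :
    Irreducible (C a * X ^ 2 + C b * X + C c) := by
  have ha : a ≠ 0 := by
    rintro rfl
    simp only [discrim] at hdisc
    nlinarith [sq_nonneg b]
  have hdeg : (C a * X ^ 2 + C b * X + C c).natDegree = 2 := natDegree_quadratic ha
  obtain ⟨h0, h1, h2⟩ := coeff_quadratic a b c
  have hunit : ∀ p : ℤ[X], p ∣ C a * X ^ 2 + C b * X + C c → p.natDegree = 0 → IsUnit p := by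
    intro p hp hp0
    rw [eq_C_of_natDegree_eq_zero hp0] at hp ⊢
    have hcoeff := C_dvd_iff_dvd_coeff _ _ |>.1 hp
    exact isUnit_C.2 (hprim _ (h2 ▸ hcoeff 2) (h1 ▸ hcoeff 1) (h0 ▸ hcoeff 0))
  refine ⟨fun h => ?_, fun f g hfg => ?_⟩
  · have := natDegree_eq_zero_of_isUnit h
    omega
  have hsum : f.natDegree + g.natDegree = 2 := by
    have hne : f * g ≠ 0 := by
      rw [← hfg]
      exact ne_zero_of_natDegree_gt (n := 0) (by omega)
    rw [← natDegree_mul (left_ne_zero_of_mul hne) (right_ne_zero_of_mul hne), ← hfg, hdeg]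
  by_cases hf : f.natDegree = 0
  · exact .inl (hunit f ⟨g, hfg⟩ hf)
  by_cases hg : g.natDegree = 0
  · exact .inr (hunit g ⟨f, hfg.trans (mul_comm f g)⟩ hg)
  obtain ⟨u, v, rfl⟩ := exists_eq_X_add_C_of_natDegree_le_one (p := f) (by omega)
  obtain ⟨w, z, rfl⟩ := exists_eq_X_add_C_of_natDegree_le_one (p := g) (by omega)
  have hexp : (C u * X + C v) * (C w * X + C z) =
      C (u * w) * X ^ 2 + C (u * z + v * w) * X + C (v * z) := by
    simp only [C_mul, C_add]
    ring
  rw [hexp] at hfg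
  obtain ⟨e0, e1, e2⟩ := coeff_quadratic (u * w) (u * z + v * w) (v * z)
  rw [← hfg] at e0 e1 e2
  rw [h0] at e0
  rw [h1] at e1
  rw [h2] at e2
  subst e0 e1 e2
  simp only [discrim] at hdisc
  nlinarith [sq_nonneg (u * z - v * w)]

theorem isCoprime_g1_of_dvd_g2 {q s : ℤ} (hmod : q % 6 = 1) (hdvd : q ∣ g2 s) :
    IsCoprime q (g1 s) := by
  obtain ⟨k, hk⟩ := hdvd
  have hq6 : IsCoprime q 6 := ⟨1, -(q / 6), by omega⟩
  have hqs : IsCoprime q s := ⟨k, -(3 * s + 3), by simp only [g2] at hk; linear_combination -hk⟩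
  have h : g1 s = -(6 * s) + q * k := by
    rw [← hk]
    simp only [g1, g2]
    ring
  rw [h]
  exact (hq6.mul_right hqs).neg_right.add_mul_left_right k

theorem mnt_k3_case_g2 (q : ℤ) (hq : Prime q) (hmod : q % 6 = 1)
    (s : ℤ) (hdvd : q ∣ g2 s) :
    (∀ x : ℤ, Phi3 (g0 (q * x + s)) =
      q * (3 * q ^ 2 * x ^ 2 + (6 * s - 3) * q * x + g1 s) *
        (3 * q * x ^ 2 + (6 * s + 3) * x + g2 s / q)) ∧
    Irreducible (C (3 * q ^ 2) * X ^ 2 + C ((6 * s - 3) * q) * X + C (g1 s)) ∧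
    Irreducible (C (3 * q) * X ^ 2 + C (6 * s + 3) * X + C (g2 s / q)) := by
  have hq0 : q ≠ 0 := hq.ne_zero
  have hcop := isCoprime_g1_of_dvd_g2 hmod hdvd
  obtain ⟨k, hk⟩ := hdvd
  have hdiv : g2 s / q = k := by rw [hk, Int.mul_ediv_cancel_left _ hq0]
  rw [hdiv]
  simp only [g2] at hk
  have hdisc : discrim (3 * q) (6 * s + 3) k = -3 := by
    simp only [discrim]
    linear_combination 12 * hk
  refine ⟨fun x => ?_, irreducible_quadratic_of_discrim_neg ?_ ?_,
    irreducible_quadratic_of_discrim_neg (by omega) ?_⟩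
  · simp only [Phi3, g0, g1]
    linear_combination
      (3 * q ^ 2 * x ^ 2 + (6 * s - 3) * q * x + (3 * s ^ 2 - 3 * s + 1)) * hk
  · have : discrim (3 * q ^ 2) ((6 * s - 3) * q) (g1 s) = -3 * q ^ 2 := by
      simp only [discrim, g1]
      ring
    have : 0 < q ^ 2 := by positivity
    omega
  · intro d h2 _ h0
    have h3 : IsCoprime 3 (g1 s) := ⟨s - s ^ 2, 1, by simp only [g1]; ring⟩
    exact (h3.mul_left hcop.pow_left).isUnit_of_dvd' h2 h0
  · rintro d ⟨x, hx⟩ ⟨y, hy⟩ ⟨z, hz⟩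
    have hd : d * d ∣ 3 := by
      refine ⟨4 * x * z - y ^ 2, ?_⟩
      rw [hx, hy, hz] at hdisc
      simp only [discrim] at hdisc
      linear_combination hdisc
    exact Int.prime_three.squarefree d hd
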